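/- Let S ⊆ ℝⁿ and let X be a derivation of C^∞(S). For each x ∈ S there exist an open neighbourhood U of x in ℝⁿ and a C^∞ vector field Y = Σ_{i=1}^{n} Fⁱ ∂/∂xⁱ on ℝⁿ (with F¹, ..., Fⁿ ∈ C^∞(ℝⁿ, ℝ)) such that X(F|_S)(y) = (Y F)(y) = Σ_{i=1}^{n} Fⁱ(y) (∂F/∂xⁱ)(y) for every C^∞ function F : ℝⁿ → ℝ and every y ∈ U ∩ S. -/

import Mathlib

/-- A function `f : S → ℝ` on a subset `S ⊆ ℝⁿ` is smooth if, for every `x ∈ S`,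
there are an open set `U ⊆ ℝⁿ` containing `x` and a `C^∞` function `F : ℝⁿ → ℝ`
agreeing with `f` on `U ∩ S`. -/
def SmoothOnSet {n : ℕ} (S : Set (Fin n → ℝ)) (f : S → ℝ) : Prop :=
  ∀ x : S, ∃ U : Set (Fin n → ℝ), IsOpen U ∧ (x : Fin n → ℝ) ∈ U ∧
    ∃ F : (Fin n → ℝ) → ℝ, ContDiff ℝ (⊤ : ℕ∞) F ∧
      ∀ y : S, (y : Fin n → ℝ) ∈ U → F y = f y

/-- A (global) derivation of `C^∞(S)`: an ℝ-linear map `X : C^∞(S) → C^∞(S)`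
satisfying Leibniz's rule. -/
def IsDerivationOn {n : ℕ} (S : Set (Fin n → ℝ))
    (X : (S → ℝ) → (S → ℝ)) : Prop :=
  (∀ f : S → ℝ, SmoothOnSet S f → SmoothOnSet S (X f)) ∧
  (∀ f g : S → ℝ, SmoothOnSet S f → SmoothOnSet S g → X (f + g) = X f + X g) ∧
  (∀ (c : ℝ) (f : S → ℝ), SmoothOnSet S f → X (c • f) = c • X f) ∧
  (∀ f g : S → ℝ, SmoothOnSet S f → SmoothOnSet S g →
    X (f * g) = X f * g + f * X g)


theorem param_hasFDerivAt {E G : Type} [NormedAddCommGroup E] [NormedSpace ℝ E] [ProperSpace E]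
    [NormedAddCommGroup G] [NormedSpace ℝ G] [CompleteSpace G]
    (f : E × ℝ → G) (hf : ContDiff ℝ 1 f) (x : E) :
    HasFDerivAt (fun x => ∫ t in (0:ℝ)..1, f (x, t))
      (∫ t in (0:ℝ)..1, (fderiv ℝ f (x, t)).comp (ContinuousLinearMap.inl ℝ E ℝ)) x := by
  have hc : Continuous f := hf.continuous
  have hd : Continuous (fun p : E × ℝ => (fderiv ℝ f p).comp (ContinuousLinearMap.inl ℝ E ℝ)) :=
    (hf.continuous_fderiv one_ne_zero).clm_comp continuous_const
  obtain ⟨C, hC⟩ := ((isCompact_closedBall x 1).prod (isCompact_Icc (a := (0:ℝ)) (b := 1))).exists_bound_of_continuousOn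
    hd.continuousOn
  apply intervalIntegral.hasFDerivAt_integral_of_dominated_of_fderiv_le
    (F := fun x t => f (x, t))
    (F' := fun x t => (fderiv ℝ f (x, t)).comp (ContinuousLinearMap.inl ℝ E ℝ))
    (bound := fun _ => C) (Metric.closedBall_mem_nhds x one_pos)
  · refine Filter.Eventually.of_forall fun y => ?_
    exact (hc.comp (by fun_prop : Continuous fun t : ℝ => (y, t))).aestronglyMeasurable
  · exact (hc.comp (by fun_prop : Continuous fun t : ℝ => (x, t))).intervalIntegrable _ _
  · exact (hd.comp (by fun_prop : Continuous fun t : ℝ => (x, t))).aestronglyMeasurable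
  · refine Filter.Eventually.of_forall fun t ht y hy => ?_
    rw [Set.uIoc_of_le zero_le_one] at ht
    exact hC (y, t) ⟨hy, ht.1.le, ht.2⟩
  · exact intervalIntegrable_const
  · refine Filter.Eventually.of_forall fun t ht y hy => ?_
    have h1 : HasFDerivAt f (fderiv ℝ f (y, t)) (y, t) :=
      (hf.differentiable one_ne_zero _).hasFDerivAt
    exact h1.comp y (hasFDerivAt_prodMk_left y t)

theorem param_contDiff {E : Type} [NormedAddCommGroup E] [NormedSpace ℝ E] [ProperSpace E]
    (n : ℕ) : ∀ {G : Type} [NormedAddCommGroup G] [NormedSpace ℝ G] [CompleteSpace G]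
    (f : E × ℝ → G), ContDiff ℝ n f →
    ContDiff ℝ n (fun x => ∫ t in (0:ℝ)..1, f (x, t)) := by
  induction n with
  | zero =>
    intro G _ _ _ f hf
    have hc : Continuous f := hf.continuous
    simp only [Nat.cast_zero, contDiff_zero]
    exact intervalIntegral.continuous_parametric_intervalIntegral_of_continuous'
      (f := fun x t => f (x, t)) hc 0 1
  | succ n ih =>
    intro G _ _ _ f hf
    push_cast at hf ⊢
    rw [contDiff_succ_iff_hasFDerivAt]
    refine ⟨_, ?_, fun x => param_hasFDerivAt f (hf.of_le (by simp)) x⟩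
    apply ih (fun p => (fderiv ℝ f p).comp (ContinuousLinearMap.inl ℝ E ℝ))
    exact (hf.fderiv_right le_rfl).clm_comp contDiff_const

theorem hadamard {n : ℕ} (F : (Fin n → ℝ) → ℝ) (hF : ContDiff ℝ (⊤ : ℕ∞) F) (y : Fin n → ℝ) :
    ∃ g : Fin n → (Fin n → ℝ) → ℝ, (∀ i, ContDiff ℝ (⊤ : ℕ∞) (g i)) ∧
      (∀ i, g i y = fderiv ℝ F y (Pi.single i 1)) ∧
      ∀ z, F z = F y + ∑ i, (z i - y i) * g i z := by
  have hF' : ContDiff ℝ (⊤ : ℕ∞) (fderiv ℝ F) := (contDiff_infty_iff_fderiv.1 hF).2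
  have hg : ContDiff ℝ (⊤ : ℕ∞)
      (fun z : Fin n → ℝ => ∫ t in (0:ℝ)..1, fderiv ℝ F (y + t • (z - y))) := by
    rw [contDiff_infty]
    intro k
    apply param_contDiff k (fun p : (Fin n → ℝ) × ℝ => fderiv ℝ F (y + p.2 • (p.1 - y)))
    refine ContDiff.comp (hF'.of_le (by exact_mod_cast le_top)) ?_
    fun_prop
  refine ⟨fun i z => (∫ t in (0:ℝ)..1, fderiv ℝ F (y + t • (z - y))) (Pi.single i 1),
    fun i => hg.clm_apply contDiff_const, fun i => by simp, fun z => ?_⟩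
  have hcont : Continuous fun t : ℝ => fderiv ℝ F (y + t • (z - y)) :=
    hF'.continuous.comp (by fun_prop)
  have key : (∫ t in (0:ℝ)..1, fderiv ℝ F (y + t • (z - y))) (z - y) = F z - F y := by
    rw [ContinuousLinearMap.intervalIntegral_apply (hcont.intervalIntegrable _ _)]
    rw [intervalIntegral.integral_eq_sub_of_hasDerivAt (f := fun t : ℝ => F (y + t • (z - y)))]
    · simp
    · intro t _
      have h1 : HasFDerivAt F (fderiv ℝ F (y + t • (z - y))) (y + t • (z - y)) :=
        (hF.differentiable (by simp) _).hasFDerivAt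
      have h2 : HasDerivAt (fun t : ℝ => y + t • (z - y)) (z - y) t := by
        simpa using ((hasDerivAt_id t).smul_const (z - y)).const_add y
      exact h1.comp_hasDerivAt t h2
    · exact (hcont.clm_apply continuous_const).intervalIntegrable _ _
  beta_reduce
  generalize (∫ t in (0:ℝ)..1, fderiv ℝ F (y + t • (z - y))) = L at key ⊢
  have : L (z - y) = ∑ i, (z i - y i) * L (Pi.single i 1) := by
    conv_lhs => rw [pi_eq_sum_univ' (z - y)]
    simp [map_sum]
  linarith

theorem smoothOnSet_restrict {n : ℕ} (S : Set (Fin n → ℝ)) (F : (Fin n → ℝ) → ℝ)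
    (hF : ContDiff ℝ (⊤ : ℕ∞) F) : SmoothOnSet S (fun z : S => F z) :=
  fun _ => ⟨Set.univ, isOpen_univ, trivial, F, hF, fun _ _ => rfl⟩

theorem derivation_const {n : ℕ} (S : Set (Fin n → ℝ))
    (X : (S → ℝ) → (S → ℝ)) (hX : IsDerivationOn S X) (c : ℝ) :
    X (fun _ => c) = 0 := by
  obtain ⟨-, -, hs, hm⟩ := hX
  have h1 : SmoothOnSet S (fun _ : S => (1:ℝ)) :=
    smoothOnSet_restrict S (fun _ => 1) contDiff_const
  have h2 : X (fun _ => 1) = 0 := by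
    have := hm _ _ h1 h1
    have e : ((fun _ : S => (1:ℝ)) * fun _ => 1) = fun _ => 1 := by ext; simp
    rw [e] at this
    funext z
    have := congrFun this z
    simp at this
    simpa using this
  have h3 := hs c _ h1
  rw [h2, smul_zero] at h3
  rw [← h3]
  congr 1
  ext; simp

theorem derivation_sum {n : ℕ} (S : Set (Fin n → ℝ))
    (X : (S → ℝ) → (S → ℝ)) (hX : IsDerivationOn S X) {ι : Type} (s : Finset ι)
    (f : ι → (Fin n → ℝ) → ℝ) (hf : ∀ i, ContDiff ℝ (⊤ : ℕ∞) (f i)) (y : S) :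
    X (fun z => ∑ i ∈ s, f i z) y = ∑ i ∈ s, X (fun z => f i z) y := by
  classical
  induction s using Finset.induction_on with
  | empty => simp [derivation_const S X hX 0]
  | insert a s ha ih =>
    rw [Finset.sum_insert ha, ← ih]
    have := hX.2.1 _ _ (smoothOnSet_restrict S _ (hf a))
      (smoothOnSet_restrict S (fun z => ∑ i ∈ s, f i z) (ContDiff.sum fun i _ => hf i))
    rw [← Pi.add_apply, ← this]
    congr 2
    ext z
    simp [Finset.sum_insert ha]

/-- every derivation of `C^∞(S)`, `S ⊆ ℝⁿ`, locally extends to a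
`C^∞` vector field `Y = Σᵢ Fⁱ ∂/∂xⁱ` on `ℝⁿ`: for each `x ∈ S` there are an open
neighbourhood `U` of `x` in `ℝⁿ` and `F¹, …, Fⁿ ∈ C^∞(ℝⁿ, ℝ)` such that
`X (F|_S) (y) = Σᵢ Fⁱ(y) (∂F/∂xⁱ)(y)` for all `C^∞` `F : ℝⁿ → ℝ` and `y ∈ U ∩ S`. -/
theorem derivationOn_locally_extends {n : ℕ} (S : Set (Fin n → ℝ))
    (X : (S → ℝ) → (S → ℝ)) (hX : IsDerivationOn S X) (x : S) :
    ∃ U : Set (Fin n → ℝ), IsOpen U ∧ (x : Fin n → ℝ) ∈ U ∧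
      ∃ G : Fin n → ((Fin n → ℝ) → ℝ), (∀ i, ContDiff ℝ (⊤ : ℕ∞) (G i)) ∧
        ∀ F : (Fin n → ℝ) → ℝ, ContDiff ℝ (⊤ : ℕ∞) F →
          ∀ y : S, (y : Fin n → ℝ) ∈ U →
            X (fun z : S => F ↑z) y =
              ∑ i : Fin n, G i ↑y * fderiv ℝ F (↑y) (Pi.single i 1) := by
  have hcoord : ∀ i : Fin n, ContDiff ℝ (⊤ : ℕ∞) (fun z : Fin n → ℝ => z i) :=
    fun i => contDiff_apply ℝ ℝ i
  have hx : ∀ i : Fin n, ∃ U : Set (Fin n → ℝ), IsOpen U ∧ (x : Fin n → ℝ) ∈ U ∧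
      ∃ F : (Fin n → ℝ) → ℝ, ContDiff ℝ (⊤ : ℕ∞) F ∧
        ∀ y : S, (y : Fin n → ℝ) ∈ U → F y = X (fun z => (z : Fin n → ℝ) i) y :=
    fun i => hX.1 _ (smoothOnSet_restrict S _ (hcoord i)) x
  choose U hU hxU G hG hGX using hx
  refine ⟨⋂ i, U i, isOpen_iInter_of_finite hU, Set.mem_iInter.2 hxU, G, hG, ?_⟩
  intro F hF y hy
  obtain ⟨g, hg, hgy, hFg⟩ := hadamard F hF y
  have hlin : ∀ i, ContDiff ℝ (⊤ : ℕ∞) (fun z : Fin n → ℝ => z i - (y : Fin n → ℝ) i) :=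
    fun i => (hcoord i).sub contDiff_const
  have hprod : ∀ i, ContDiff ℝ (⊤ : ℕ∞)
      (fun z : Fin n → ℝ => (z i - (y : Fin n → ℝ) i) * g i z) :=
    fun i => (hlin i).mul (hg i)
  have e : (fun z : S => F z) = (fun _ : S => F y) +
      fun z : S => ∑ i, ((z : Fin n → ℝ) i - (y : Fin n → ℝ) i) * g i z := by
    ext z
    simpa using hFg z
  rw [e, hX.2.1 _ _ (smoothOnSet_restrict S (fun _ => F y) contDiff_const)
    (smoothOnSet_restrict S (fun z => ∑ i, (z i - (y : Fin n → ℝ) i) * g i z)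
      (ContDiff.sum fun i _ => hprod i)), derivation_const S X hX, zero_add,
    derivation_sum S X hX Finset.univ
      (fun i z => (z i - (y : Fin n → ℝ) i) * g i z) hprod]
  refine Finset.sum_congr rfl fun i _ => ?_
  have h1 := congrFun (hX.2.2.2 _ _ (smoothOnSet_restrict S _ (hlin i))
    (smoothOnSet_restrict S _ (hg i))) y
  have h2 : X (fun z : S => (z : Fin n → ℝ) i - (y : Fin n → ℝ) i)
      = X (fun z : S => (z : Fin n → ℝ) i) := by
    have := hX.2.1 _ _ (smoothOnSet_restrict S _ (hcoord i))
      (smoothOnSet_restrict S (fun _ => -(y : Fin n → ℝ) i) contDiff_const)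
    rw [derivation_const S X hX, add_zero] at this
    rw [← this]
    congr 1
  rw [h2] at h1
  rw [hGX i y (Set.mem_iInter.1 hy i), ← hgy i]
  refine Eq.trans ?_ (h1.trans ?_)
  · rfl
  · simp
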